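/- Let S be a virtual flat biquandle and let C_n'(S) ⊆ C_n(S) be the subgroup generated by elements of the form (a_1,...,a_i,a_{i+1},...,a_n) + (a_1,...,a_{i+1}∘a_i, a_i*a_{i+1},...,a_n) for 1 ≤ i ≤ n-1 (n ≥ 2), with C_n'(S) = 0 for n ≤ 1. Then ∂_n(C_n'(S)) ⊆ C_{n-1}'(S), i.e. C_*'(S) is a subcomplex of (C_*(S), ∂). -/

import Mathlib

/-- A virtual flat biquandle: a set with two binary operations
`star a b = S_b(a)` and `circ a b = T_b(a)` satisfying
(i) `S_a S_b = S_b S_a`, `T_a T_b = T_b T_a`, `S_a T_b = T_b S_a`;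
(ii) `S_a = S_{T_b(a)} = S_{S_b(a)}`, `T_a = T_{S_b(a)} = T_{T_b(a)}`;
(iii) `T_a S_a = S_a T_a = id`. -/
structure VFB (S : Type*) where
  star : S → S → S
  circ : S → S → S
  star_star_comm : ∀ a b x, star (star x b) a = star (star x a) b
  circ_circ_comm : ∀ a b x, circ (circ x b) a = circ (circ x a) b
  star_circ_comm : ∀ a b x, star (circ x b) a = circ (star x a) b
  star_circ_invar : ∀ a b x, star x (circ a b) = star x a
  star_star_invar : ∀ a b x, star x (star a b) = star x a
  circ_star_invar : ∀ a b x, circ x (star a b) = circ x a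
  circ_circ_invar : ∀ a b x, circ x (circ a b) = circ x a
  circ_star : ∀ a x, circ (star x a) a = x
  star_circ : ∀ a x, star (circ x a) a = x

/-- the chain group `C_n(S)`: free abelian group on `n`-tuples of elements of `S` -/
def C (S : Type*) (n : ℕ) : Type _ := FreeAbelianGroup (Fin n → S)

instance (S : Type*) (n : ℕ) : AddCommGroup (C S n) :=
  inferInstanceAs (AddCommGroup (FreeAbelianGroup (Fin n → S)))

variable {S : Type*}

/-- the tuple `(a_1*a_i, …, a_{i-1}*a_i, a_{i+1}, …, a_n)` -/
def leftFace (V : VFB S) {n : ℕ} (i : Fin (n + 1)) (a : Fin (n + 1) → S) :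
    Fin n → S :=
  fun j => if (j : ℕ) < (i : ℕ) then V.star (a j.castSucc) (a i) else a j.succ

/-- the tuple `(a_1, …, a_{i-1}, a_{i+1}∘a_i, …, a_n∘a_i)` -/
def rightFace (V : VFB S) {n : ℕ} (i : Fin (n + 1)) (a : Fin (n + 1) → S) :
    Fin n → S :=
  fun j => if (j : ℕ) < (i : ℕ) then a j.castSucc else V.circ (a j.succ) (a i)

/-- the boundary map `∂_{n+1} : C_{n+1}(S) → C_n(S)`,
`∂(a_1,…,a_n) = Σ_i (-1)^i [(a_1*a_i,…,a_{i-1}*a_i,a_{i+1},…,a_n)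
  - (a_1,…,a_{i-1},a_{i+1}∘a_i,…,a_n∘a_i)]` -/
def bdry (V : VFB S) {n : ℕ} : C S (n + 1) →+ C S n :=
  FreeAbelianGroup.lift fun a : Fin (n + 1) → S =>
    ∑ i : Fin (n + 1),
      ((-1 : ℤ) ^ ((i : ℕ) + 1)) •
        (FreeAbelianGroup.of (leftFace V i a) - FreeAbelianGroup.of (rightFace V i a))

/-- the tuple `(a_1, …, a_{i+1}∘a_i, a_i*a_{i+1}, …, a_n)` obtained from `a`
by replacing the adjacent pair at positions `i, i+1`. -/
def swapPair (V : VFB S) {n : ℕ} (i : ℕ) (hi : i + 1 < n) (a : Fin n → S) :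
    Fin n → S :=
  fun j =>
    if (j : ℕ) = i then V.circ (a ⟨i + 1, hi⟩) (a ⟨i, Nat.lt_of_succ_lt hi⟩)
    else if (j : ℕ) = i + 1 then V.star (a ⟨i, Nat.lt_of_succ_lt hi⟩) (a ⟨i + 1, hi⟩)
    else a j

/-- the subgroup `C'_n(S)` generated by the elements
`(a_1,…,a_i,a_{i+1},…,a_n) + (a_1,…,a_{i+1}∘a_i,a_i*a_{i+1},…,a_n)` -/
def Csub (V : VFB S) (n : ℕ) : AddSubgroup (C S n) :=
  AddSubgroup.closure
    {x | ∃ (a : Fin n → S) (i : ℕ) (hi : i + 1 < n),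
      x = FreeAbelianGroup.of a + FreeAbelianGroup.of (swapPair V i hi a)}

section Faces

variable (V : VFB S) {n : ℕ} (p : ℕ) (hp : p + 1 < n + 1) (a : Fin (n + 1) → S)

lemma leftFace_swapPair_self :
    leftFace V ⟨p, Nat.lt_of_succ_lt hp⟩ (swapPair V p hp a) = leftFace V ⟨p + 1, hp⟩ a := by
  funext j
  rcases lt_trichotomy (j : ℕ) p with h | h | h
  · have h1 : (j : ℕ) < p + 1 := by omega
    simp [leftFace, swapPair, h, h1, h.ne, h1.ne, V.star_circ_invar]
  · subst h
    simp [leftFace, swapPair]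
    rfl
  · have h1 : ¬ (j : ℕ) < p := by omega
    have h2 : ¬ (j : ℕ) < p + 1 := by omega
    have h3 : ¬ (j : ℕ) + 1 = p := by omega
    have h4 : ¬ (j : ℕ) = p := by omega
    simp [leftFace, swapPair, h1, h2, h3, h4]

lemma leftFace_swapPair_succ :
    leftFace V ⟨p + 1, hp⟩ (swapPair V p hp a) = leftFace V ⟨p, Nat.lt_of_succ_lt hp⟩ a := by
  funext j
  rcases lt_trichotomy (j : ℕ) p with h | h | h
  · have h1 : (j : ℕ) < p + 1 := by omega
    simp [leftFace, swapPair, h, h1, h.ne, h1.ne, V.star_star_invar]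
  · subst h
    simp [leftFace, swapPair, V.star_star_invar, V.star_circ]
    rfl
  · have h1 : ¬ (j : ℕ) < p := by omega
    have h2 : ¬ (j : ℕ) < p + 1 := by omega
    have h3 : ¬ (j : ℕ) + 1 = p := by omega
    have h4 : ¬ (j : ℕ) = p := by omega
    simp [leftFace, swapPair, h1, h2, h3, h4]

lemma rightFace_swapPair_self :
    rightFace V ⟨p, Nat.lt_of_succ_lt hp⟩ (swapPair V p hp a) = rightFace V ⟨p + 1, hp⟩ a := by
  funext j
  rcases lt_trichotomy (j : ℕ) p with h | h | h
  · have h1 : (j : ℕ) < p + 1 := by omega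
    simp [rightFace, swapPair, h, h1, h.ne, h1.ne]
  · subst h
    simp [rightFace, swapPair, V.circ_circ_invar, V.circ_star]
    rfl
  · have h1 : ¬ (j : ℕ) < p := by omega
    have h2 : ¬ (j : ℕ) < p + 1 := by omega
    have h3 : ¬ (j : ℕ) + 1 = p := by omega
    have h4 : ¬ (j : ℕ) = p := by omega
    simp [rightFace, swapPair, h1, h2, h3, h4, V.circ_circ_invar]

lemma rightFace_swapPair_succ :
    rightFace V ⟨p + 1, hp⟩ (swapPair V p hp a) = rightFace V ⟨p, Nat.lt_of_succ_lt hp⟩ a := by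
  funext j
  rcases lt_trichotomy (j : ℕ) p with h | h | h
  · have h1 : (j : ℕ) < p + 1 := by omega
    simp [rightFace, swapPair, h, h1, h.ne, h1.ne]
  · subst h
    simp [rightFace, swapPair]
    rfl
  · have h1 : ¬ (j : ℕ) < p := by omega
    have h2 : ¬ (j : ℕ) < p + 1 := by omega
    have h3 : ¬ (j : ℕ) + 1 = p := by omega
    have h4 : ¬ (j : ℕ) = p := by omega
    simp [rightFace, swapPair, h1, h2, h3, h4, V.circ_star_invar]

variable (k : Fin (n + 1))

lemma leftFace_swapPair_of_lt (q : ℕ) (hq : q + 1 + 1 < n + 1) (h : (k : ℕ) < q + 1) :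
    leftFace V k (swapPair V (q + 1) hq a) =
      swapPair V q (Nat.lt_of_succ_lt_succ hq) (leftFace V k a) := by
  funext j
  have h1 : ¬ q < (k : ℕ) := by omega
  have h2 : ¬ q + 1 < (k : ℕ) := by omega
  have h3 : ¬ (k : ℕ) = q + 1 := by omega
  have h4 : ¬ (k : ℕ) = q + 1 + 1 := by omega
  by_cases hj : (j : ℕ) < k
  · have h5 : ¬ (j : ℕ) = q := by omega
    have h6 : ¬ (j : ℕ) = q + 1 := by omega
    have h7 : ¬ (j : ℕ) = q + 1 + 1 := by omega
    simp [leftFace, swapPair, *]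
  · simp [leftFace, swapPair, *]

lemma rightFace_swapPair_of_lt (q : ℕ) (hq : q + 1 + 1 < n + 1) (h : (k : ℕ) < q + 1) :
    rightFace V k (swapPair V (q + 1) hq a) =
      swapPair V q (Nat.lt_of_succ_lt_succ hq) (rightFace V k a) := by
  funext j
  have h1 : ¬ q < (k : ℕ) := by omega
  have h2 : ¬ q + 1 < (k : ℕ) := by omega
  have h3 : ¬ (k : ℕ) = q + 1 := by omega
  have h4 : ¬ (k : ℕ) = q + 1 + 1 := by omega
  by_cases hj : (j : ℕ) < k
  · have h5 : ¬ (j : ℕ) = q := by omega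
    have h6 : ¬ (j : ℕ) = q + 1 := by omega
    have h7 : ¬ (j : ℕ) = q + 1 + 1 := by omega
    simp [rightFace, swapPair, *]
  · simp only [rightFace, swapPair, Fin.val_succ, Nat.add_right_cancel_iff, Fin.succ_mk, if_neg,
      h1, h2, h3, h4, hj, V.circ_circ_invar, V.star_circ_invar, not_false_eq_true]
    split_ifs
    · exact V.circ_circ_comm _ _ _
    · exact (V.star_circ_comm _ _ _).symm
    · rfl

lemma leftFace_swapPair_of_gt (hk : p + 1 < (k : ℕ)) :
    leftFace V k (swapPair V p hp a) =
      swapPair V p (lt_of_lt_of_le hk (Nat.le_of_lt_succ k.isLt)) (leftFace V k a) := by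
  funext j
  have h1 : p < (k : ℕ) := by omega
  have h3 : ¬ (k : ℕ) = p := by omega
  have h4 : ¬ (k : ℕ) = p + 1 := by omega
  by_cases hj : (j : ℕ) < k
  · simp only [leftFace, swapPair, Fin.val_castSucc, Fin.castSucc_mk, if_true, if_neg,
      h1, hk, h3, h4, hj, V.star_star_invar, V.circ_star_invar, not_false_eq_true]
    split_ifs
    · exact V.star_circ_comm _ _ _
    · exact V.star_star_comm _ _ _
    · rfl
  · have h5 : ¬ (j : ℕ) = p := by omega
    have h6 : ¬ (j : ℕ) = p + 1 := by omega
    have h7 : ¬ (j : ℕ) + 1 = p := by omega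
    simp [leftFace, swapPair, *]

lemma rightFace_swapPair_of_gt (hk : p + 1 < (k : ℕ)) :
    rightFace V k (swapPair V p hp a) =
      swapPair V p (lt_of_lt_of_le hk (Nat.le_of_lt_succ k.isLt)) (rightFace V k a) := by
  funext j
  have h1 : p < (k : ℕ) := by omega
  have h3 : ¬ (k : ℕ) = p := by omega
  have h4 : ¬ (k : ℕ) = p + 1 := by omega
  by_cases hj : (j : ℕ) < k
  · simp [rightFace, swapPair, *]
  · have h5 : ¬ (j : ℕ) = p := by omega
    have h6 : ¬ (j : ℕ) = p + 1 := by omega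
    have h7 : ¬ (j : ℕ) + 1 = p := by omega
    simp [rightFace, swapPair, *]

/-- A tuple regarded as a generator of the chain group. -/
def chainOf {m : ℕ} (b : Fin m → S) : C S m :=
  FreeAbelianGroup.of b

/-- The difference of the two `k`-th faces of a tuple. -/
def faceDiff (k : Fin (n + 1)) (a : Fin (n + 1) → S) : C S n :=
  chainOf (leftFace V k a) - chainOf (rightFace V k a)

lemma bdry_chainOf :
    bdry V (chainOf a) =
      ∑ i : Fin (n + 1), ((-1 : ℤ) ^ ((i : ℕ) + 1)) • faceDiff V i a :=
  FreeAbelianGroup.lift_apply_of _ _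

lemma chainOf_add_swapPair_mem {m : ℕ} (q : ℕ) (hq : q + 1 < m) (b : Fin m → S) :
    chainOf b + chainOf (swapPair V q hq b) ∈ Csub V m :=
  AddSubgroup.subset_closure ⟨b, q, hq, rfl⟩

lemma faceDiff_add_swapPair_mem (hk : (k : ℕ) ≠ p) (hk' : (k : ℕ) ≠ p + 1) :
    faceDiff V k a + faceDiff V k (swapPair V p hp a) ∈ Csub V n := by
  unfold faceDiff
  rw [sub_add_sub_comm]
  rcases lt_or_gt_of_ne hk with h | h
  · obtain ⟨q, rfl⟩ : ∃ q, p = q + 1 := ⟨p - 1, by omega⟩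
    rw [leftFace_swapPair_of_lt V a k q hp h, rightFace_swapPair_of_lt V a k q hp h]
    exact (Csub V n).sub_mem (chainOf_add_swapPair_mem V _ _ _) (chainOf_add_swapPair_mem V _ _ _)
  · have h' : p + 1 < (k : ℕ) := by omega
    rw [leftFace_swapPair_of_gt V p hp a k h', rightFace_swapPair_of_gt V p hp a k h']
    exact (Csub V n).sub_mem (chainOf_add_swapPair_mem V _ _ _) (chainOf_add_swapPair_mem V _ _ _)

lemma bdry_chainOf_add_swapPair_mem :
    bdry V (chainOf a + chainOf (swapPair V p hp a)) ∈ Csub V n := by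
  have key : bdry V (chainOf a + chainOf (swapPair V p hp a)) =
      ∑ i : Fin (n + 1), ((-1 : ℤ) ^ ((i : ℕ) + 1)) •
        (faceDiff V i a + faceDiff V i (swapPair V p hp a)) := by
    simp only [smul_add, Finset.sum_add_distrib, ← bdry_chainOf]
    exact map_add (bdry V) _ _
  have hne : (⟨p + 1, hp⟩ : Fin (n + 1)) ≠ ⟨p, Nat.lt_of_succ_lt hp⟩ := by simp
  rw [key, ← Finset.add_sum_erase _ _ (Finset.mem_univ ⟨p, Nat.lt_of_succ_lt hp⟩),
    ← Finset.add_sum_erase _ _ (Finset.mem_erase.2 ⟨hne, Finset.mem_univ _⟩), ← add_assoc]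
  refine (Csub V n).add_mem ?_ ((Csub V n).sum_mem fun k hk => (Csub V n).zsmul_mem ?_ _)
  · convert (Csub V n).zero_mem
    have h1 : faceDiff V ⟨p, Nat.lt_of_succ_lt hp⟩ (swapPair V p hp a) =
        faceDiff V ⟨p + 1, hp⟩ a := by
      unfold faceDiff
      rw [leftFace_swapPair_self, rightFace_swapPair_self]
    have h2 : faceDiff V ⟨p + 1, hp⟩ (swapPair V p hp a) =
        faceDiff V ⟨p, Nat.lt_of_succ_lt hp⟩ a := by
      unfold faceDiff
      rw [leftFace_swapPair_succ, rightFace_swapPair_succ]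
    rw [h1, h2, pow_succ _ (p + 1), mul_neg_one, neg_smul, add_comm (faceDiff V ⟨p + 1, hp⟩ a),
      add_neg_cancel]
  · simp only [Finset.mem_erase, Finset.mem_univ, and_true, ne_eq, Fin.ext_iff] at hk
    exact faceDiff_add_swapPair_mem V p hp a k hk.2 hk.1

end Faces

theorem stmt_14 (V : VFB S) (n : ℕ) (x : C S (n + 1)) (hx : x ∈ Csub V (n + 1)) :
    bdry V x ∈ Csub V n := by
  have h : Csub V (n + 1) ≤ (Csub V n).comap (bdry V) := by
    refine (AddSubgroup.closure_le _).2 ?_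
    rintro _ ⟨a, p, hp, rfl⟩
    exact bdry_chainOf_add_swapPair_mem V p hp a
  exact h hx
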